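/- Let n be an odd integer with n > 3, and let c₁ be the minimum of f(n,p) taken over all primes p with 3 ≤ p ≤ ⌈√n⌉ (equivalently, the smallest odd composite exceeding n). Then n + 2 is composite if and only if c₁ − n = 2. -/

import Mathlib

/-- `f n x = n + 2x - ((n - x) mod 2x)`, computed in the integers, where
`%` is the Euclidean remainder (nonnegative for a positive modulus). -/
def f (n x : ℤ) : ℤ := n + 2 * x - (n - x) % (2 * x)

/-- A composite number: an integer greater than 1 that is not prime. -/
def IsComposite (m : ℤ) : Prop := 1 < m ∧ ¬ Prime m

theorem add_two_le_f {n p : ℤ} (hn : Odd n) (hp : Odd p) (hp0 : 0 < p) : n + 2 ≤ f n p := by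
  have hlt := Int.emod_lt_of_pos (n - p) (b := 2 * p) (by lia)
  have hdiv := Int.emod_add_mul_ediv (n - p) (2 * p)
  rw [mul_assoc] at hdiv
  obtain ⟨a, rfl⟩ := hn
  obtain ⟨b, rfl⟩ := hp
  unfold f
  lia

theorem f_eq_add_two_iff_dvd {n p : ℤ} (hn : Odd n) (hp0 : 0 < p) :
    f n p = n + 2 ↔ p ∣ n + 2 := by
  unfold f
  constructor
  · intro h
    have hdiv := Int.emod_add_mul_ediv (n - p) (2 * p)
    exact ⟨2 * ((n - p) / (2 * p)) + 3, by linear_combination -hdiv - h⟩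
  · rintro ⟨k, hk⟩
    have hodd : Odd (p * k) := hk ▸ hn.add_even even_two
    obtain ⟨j, rfl⟩ := (Int.odd_mul.mp hodd).2
    have hmod : (n - p) % (2 * p) = 2 * p - 2 := by
      rw [show n - p = (2 * p - 2) + 2 * p * (j - 1) by linear_combination hk,
        Int.add_mul_emod_self_left]
      exact Int.emod_eq_of_lt (by lia) (by lia)
    rw [hmod]
    ring

theorem Prime.odd_of_three_le {p : ℤ} (hp : Prime p) (h3 : 3 ≤ p) : Odd p := by
  have := (Int.prime_iff_natAbs_prime.mp hp).odd_of_ne_two (by lia)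
  exact Int.natAbs_odd.mp this

theorem ceil_sqrt_le_self {n : ℤ} (hn : 0 < n) : ⌈Real.sqrt (n : ℝ)⌉ ≤ n := by
  rw [Int.ceil_le, Real.sqrt_le_left (by exact_mod_cast hn.le)]
  exact_mod_cast (by nlinarith : n ≤ n ^ 2)

theorem le_ceil_sqrt_of_sq_le_add_two {n p : ℤ} (hp : 3 ≤ p) (h : p ^ 2 ≤ n + 2) :
    p ≤ ⌈Real.sqrt (n : ℝ)⌉ := by
  by_contra! hlt
  have hle : Real.sqrt (n : ℝ) ≤ ((p - 1 : ℤ) : ℝ) := Int.ceil_le.mp (by lia)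
  rw [Real.sqrt_le_left (by exact_mod_cast (by lia : 0 ≤ p - 1))] at hle
  have hsq : n ≤ (p - 1) ^ 2 := by exact_mod_cast hle
  nlinarith

theorem IsComposite.exists_prime_sq_le {m : ℤ} (hm : IsComposite m) :
    ∃ p : ℤ, Prime p ∧ 2 ≤ p ∧ p ∣ m ∧ p ^ 2 ≤ m := by
  obtain ⟨h1, hnp⟩ := hm
  lift m to ℕ using by lia
  rw [← Nat.prime_iff_prime_int] at hnp
  have hmin : m.minFac.Prime := Nat.minFac_prime (by lia)
  exact ⟨m.minFac, Nat.prime_iff_prime_int.mp hmin, by exact_mod_cast hmin.two_le,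
    by exact_mod_cast m.minFac_dvd, by exact_mod_cast Nat.minFac_sq_le_self (by lia) hnp⟩

/-- For odd `n > 3`, with `c₁` the minimum of `f n p` over primes
`p` with `3 ≤ p ≤ ⌈√n⌉`, the number `n + 2` is composite iff `c₁ - n = 2`. -/
theorem composite_test_gap (n : ℤ) (hnodd : Odd n) (hn : 3 < n) (c₁ : ℤ)
    (hc : IsLeast {m : ℤ | ∃ p : ℤ, Prime p ∧ 3 ≤ p ∧ p ≤ ⌈Real.sqrt (n : ℝ)⌉ ∧
        m = f n p} c₁) :
    IsComposite (n + 2) ↔ c₁ - n = 2 := by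
  obtain ⟨⟨q, hq, hq3, hqle, rfl⟩, hleast⟩ := hc
  rw [sub_eq_iff_eq_add']
  constructor
  · intro hcomp
    obtain ⟨p, hp, hp2, hdvd, hsq⟩ := hcomp.exists_prime_sq_le
    have hp3 : 3 ≤ p := by
      have : p ≠ 2 := by
        rintro rfl
        obtain ⟨a, rfl⟩ := hnodd
        lia
      lia
    apply le_antisymm _ (add_two_le_f hnodd (hq.odd_of_three_le hq3) (by lia))
    rw [← (f_eq_add_two_iff_dvd hnodd (by lia : 0 < p)).mpr hdvd]
    exact hleast ⟨p, hp, hp3, le_ceil_sqrt_of_sq_le_add_two hp3 hsq, rfl⟩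
  · intro h
    have hdvd := (f_eq_add_two_iff_dvd hnodd (by lia)).mp h
    refine ⟨by lia, fun hprime => ?_⟩
    have hqn := hqle.trans (ceil_sqrt_le_self (by lia))
    rcases Int.associated_iff.mp ((hq.dvd_prime_iff_associated hprime).mp hdvd) with h | h <;> lia
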